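/- Let K be a compact line with minimum 0. The map M(K) → NBV(K) sending a finite signed regular Borel measure μ to the function F_μ defined by F_μ(t) = μ([0,t]) is a linear isometry onto NBV(K), where NBV(K) carries the norm ‖F‖ = |F(0)| + V(F) (V(F) the total variation of F) and M(K) the total variation norm. -/

import Mathlib

open MeasureTheory Set

/-- The total variation of `F : K → ℝ`. -/
noncomputable def variation {K : Type*} [LinearOrder K] (F : K → ℝ) : ℝ :=
  sSup {v | ∃ (n : ℕ) (t : Fin (n + 1) → K), StrictMono t ∧
    v = ∑ i : Fin n, |F (t i.succ) - F (t i.castSucc)|}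

/-- `F` has bounded variation. -/
def IsBV {K : Type*} [LinearOrder K] (F : K → ℝ) : Prop :=
  BddAbove {v | ∃ (n : ℕ) (t : Fin (n + 1) → K), StrictMono t ∧
    v = ∑ i : Fin n, |F (t i.succ) - F (t i.castSucc)|}

/-- `F` is right-continuous. -/
def RightCts {K : Type*} [LinearOrder K] [TopologicalSpace K] (F : K → ℝ) : Prop :=
  ∀ t : K, ContinuousWithinAt F (Set.Ici t) t


section helpers
open Filter Topology

theorem regular_of_le {K : Type*} [TopologicalSpace K] [T2Space K] [MeasurableSpace K] [BorelSpace K]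
    {μ ν : Measure K} [IsFiniteMeasure μ] (hμ : μ.Regular) (h : ν ≤ μ) : ν.Regular := by
  have : IsFiniteMeasure ν := isFiniteMeasure_of_le μ h
  have : ν.InnerRegular := by
    constructor
    intro A hA r hr
    have hε : ν A - r ≠ 0 := (tsub_pos_of_lt hr).ne'
    obtain ⟨C, hCA, hC, hlt⟩ := hA.exists_isCompact_sdiff_lt (measure_ne_top μ A) hε
    refine ⟨C, hCA, hC, ?_⟩
    have h1 : ν (A \ C) < ν A - r := (h _).trans_lt hlt
    have h2 : ν A ≤ ν C + ν (A \ C) := by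
      rw [measure_add_sdiff hC.measurableSet.nullMeasurableSet]
      exact measure_mono subset_union_right
    by_contra hcon
    push Not at hcon
    have h3 : ν (A \ C) + r < ν A := lt_tsub_iff_right.1 h1
    have : ν A < ν A := h2.trans_lt (lt_of_le_of_lt (by rw [add_comm]; gcongr) h3)
    exact lt_irrefl _ this
  infer_instance

/-- The sigma-algebra generated by initial segments. -/
@[reducible] def segAlg (K : Type*) [LinearOrder K] : MeasurableSpace K :=
  MeasurableSpace.generateFrom (range (Iic : K → Set K) ∪ range (Iio : K → Set K))

theorem seg_sandwich {K : Type*} [LinearOrder K] [TopologicalSpace K] [OrderTopology K]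
    {C U : Set K} (hC : IsCompact C) (hU : IsOpen U) (hCU : C ⊆ U) :
    ∃ W, MeasurableSet[segAlg K] W ∧ C ⊆ W ∧ W ⊆ U := by
  have hIio : ∀ a : K, MeasurableSet[segAlg K] (Iio a) := fun a =>
    MeasurableSpace.measurableSet_generateFrom (Or.inr ⟨a, rfl⟩)
  have hIoi : ∀ a : K, MeasurableSet[segAlg K] (Ioi a) := fun a => by
    rw [← compl_Iic]
    exact (MeasurableSpace.measurableSet_generateFrom (Or.inl ⟨a, rfl⟩)).compl
  have hb := TopologicalSpace.isTopologicalBasis_of_subbasis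
    (OrderTopology.topology_eq_generate_intervals (α := K))
  have key : ∃ W, MeasurableSet[segAlg K] W ∧ C ∩ U ⊆ W ∧ W ⊆ U := by
    refine hC.induction_on (p := fun s => ∃ W, MeasurableSet[segAlg K] W ∧ s ∩ U ⊆ W ∧ W ⊆ U)
      ?_ ?_ ?_ ?_
    · exact ⟨∅, @MeasurableSet.empty _ (segAlg K), by simp, by simp⟩
    · rintro s t hst ⟨W, h1, h2, h3⟩
      exact ⟨W, h1, (inter_subset_inter_left _ hst).trans h2, h3⟩
    · rintro s t ⟨W, h1, h2, h3⟩ ⟨W', h1', h2', h3'⟩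
      refine ⟨W ∪ W', MeasurableSet.union h1 h1', ?_, union_subset h3 h3'⟩
      rw [union_inter_distrib_right]
      exact union_subset_union h2 h2'
    · intro x hx
      obtain ⟨v, hv, hxv, hvU⟩ := hb.exists_subset_of_mem_open (hCU hx) hU
      refine ⟨v, mem_nhdsWithin_of_mem_nhds ((hb.isOpen hv).mem_nhds hxv), v, ?_, inter_subset_left,
        hvU⟩
      obtain ⟨f, ⟨hf, hf'⟩, rfl⟩ := hv
      refine MeasurableSet.sInter hf.countable ?_
      intro s hs
      obtain ⟨a, rfl | rfl⟩ := hf' hs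
      · exact hIoi a
      · exact hIio a
  obtain ⟨W, h1, h2, h3⟩ := key
  exact ⟨W, h1, fun x hx => h2 ⟨hx, hCU hx⟩, h3⟩

theorem segAlg_le {K : Type*} [LinearOrder K] [TopologicalSpace K] [OrderTopology K]
    [MeasurableSpace K] [BorelSpace K] : segAlg K ≤ ‹MeasurableSpace K› := by
  refine MeasurableSpace.generateFrom_le ?_
  rintro s (⟨a, rfl⟩ | ⟨a, rfl⟩)
  · exact isClosed_Iic.measurableSet
  · exact isOpen_Iio.measurableSet

theorem iio_le_of_iic {K : Type*} [LinearOrder K] [TopologicalSpace K] [OrderTopology K]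
    [MeasurableSpace K] [BorelSpace K] {μ ν : Measure K} [μ.Regular]
    (h : ∀ t, μ (Iic t) = ν (Iic t)) (a : K) : μ (Iio a) ≤ ν (Iio a) := by
  refine le_of_forall_lt fun r hr => ?_
  obtain ⟨C, hCU, hC, hr'⟩ := (isOpen_Iio (a := a)).exists_lt_isCompact hr
  rcases C.eq_empty_or_nonempty with rfl | hne
  · simp at hr'
  obtain ⟨b, hb⟩ := hC.exists_isGreatest hne
  calc r < μ C := hr'
    _ ≤ μ (Iic b) := measure_mono fun x hx => hb.2 hx
    _ = ν (Iic b) := h b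
    _ ≤ ν (Iio a) := measure_mono fun x hx => lt_of_le_of_lt hx (hCU hb.1)

theorem regular_unique {K : Type*} [LinearOrder K] [TopologicalSpace K] [OrderTopology K]
    [CompactSpace K] [Nonempty K] [MeasurableSpace K] [BorelSpace K] {μ ν : Measure K}
    [IsFiniteMeasure μ] [IsFiniteMeasure ν] [μ.Regular] [ν.Regular]
    (h : ∀ t, μ (Iic t) = ν (Iic t)) : μ = ν := by
  have hIio : ∀ a, μ (Iio a) = ν (Iio a) := fun a =>
    le_antisymm (iio_le_of_iic h a) (iio_le_of_iic (fun t => (h t).symm) a)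
  obtain ⟨m, hm⟩ : ∃ m : K, ∀ t, t ≤ m := by
    obtain ⟨m, hm⟩ := isCompact_univ.exists_isGreatest (univ_nonempty (α := K))
    exact ⟨m, fun t => hm.2 trivial⟩
  have hseg : ∀ W, MeasurableSet[segAlg K] W → μ W = ν W := by
    intro W hW
    have := @MeasureTheory.ext_of_generate_finite K (segAlg K) (μ.trim segAlg_le) (ν.trim segAlg_le) _
      (rfl : segAlg K = _) ?_ (isFiniteMeasure_trim _) ?_ ?_
    · rw [← trim_measurableSet_eq segAlg_le hW, this, trim_measurableSet_eq segAlg_le hW]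
    · rintro s (⟨a, rfl⟩ | ⟨a, rfl⟩) t (⟨b, rfl⟩ | ⟨b, rfl⟩) -
      · exact Or.inl ⟨a ⊓ b, by ext; simp⟩
      · rcases lt_or_ge a b with hab | hab
        · refine Or.inl ⟨a, ?_⟩
          ext x; simp only [mem_Iic, mem_inter_iff, mem_Iio]; grind
        · refine Or.inr ⟨b, ?_⟩
          ext x; simp only [mem_Iic, mem_inter_iff, mem_Iio]; grind
      · rcases lt_or_ge b a with hab | hab
        · refine Or.inl ⟨b, ?_⟩
          ext x; simp only [mem_Iic, mem_inter_iff, mem_Iio]; grind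
        · refine Or.inr ⟨a, ?_⟩
          ext x; simp only [mem_Iic, mem_inter_iff, mem_Iio]; grind
      · exact Or.inr ⟨a ⊓ b, by ext; simp⟩
    · intro s hs
      rw [trim_measurableSet_eq segAlg_le (MeasurableSpace.measurableSet_generateFrom hs),
        trim_measurableSet_eq segAlg_le (MeasurableSpace.measurableSet_generateFrom hs)]
      rcases hs with ⟨a, rfl⟩ | ⟨a, rfl⟩
      · exact h a
      · exact hIio a
    · rw [trim_measurableSet_eq segAlg_le MeasurableSet.univ,
        trim_measurableSet_eq segAlg_le MeasurableSet.univ]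
      have : (univ : Set K) = Iic m := by ext x; simp [hm]
      rw [this]; exact h m
  refine Measure.OuterRegular.ext_isOpen fun U hU => ?_
  apply le_antisymm
  · refine le_of_forall_lt fun r hr => ?_
    obtain ⟨C, hCU, hC, hr'⟩ := hU.exists_lt_isCompact hr
    obtain ⟨W, hW, h1, h2⟩ := seg_sandwich hC hU hCU
    exact (hr'.trans_le (measure_mono h1)).trans_le ((hseg W hW).le.trans (measure_mono h2))
  · refine le_of_forall_lt fun r hr => ?_
    obtain ⟨C, hCU, hC, hr'⟩ := hU.exists_lt_isCompact hr
    obtain ⟨W, hW, h1, h2⟩ := seg_sandwich hC hU hCU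
    exact (hr'.trans_le (measure_mono h1)).trans_le ((hseg W hW).ge.trans (measure_mono h2))

theorem measurable_comp_of_mono {K : Type*} [LinearOrder K] [TopologicalSpace K] [OrderTopology K]
    [CompactSpace K] {q : ℝ → K} (hq : Monotone q) {f : K → ℝ} (hf : Continuous f) :
    Measurable (fun u => f (q u)) := by
  have hW : ∀ W, MeasurableSet[segAlg K] W → MeasurableSet (q ⁻¹' W) := by
    have : @Measurable _ _ _ (segAlg K) q := by
      refine @measurable_generateFrom _ _ _ _ _ ?_
      rintro s (⟨a, rfl⟩ | ⟨a, rfl⟩)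
      · exact (ordConnected_Iic.preimage_mono hq).measurableSet
      · exact (ordConnected_Iio.preimage_mono hq).measurableSet
    exact fun W hW => this hW
  refine measurable_of_Ioi fun c => ?_
  have hs : ∀ n : ℕ, ∃ W, MeasurableSet[segAlg K] W ∧ {x | c + 1 / ((n : ℝ) + 1) ≤ f x} ⊆ W ∧
      W ⊆ {x | c < f x} := fun n => by
    refine seg_sandwich (isClosed_le continuous_const hf).isCompact (isOpen_lt continuous_const hf) ?_
    intro x hx
    have : 0 < 1 / ((n : ℝ) + 1) := by positivity
    simp only [mem_ofPred_eq] at hx ⊢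
    linarith
  choose W hWm hW1 hW2 using hs
  have : (fun u => f (q u)) ⁻¹' Ioi c = ⋃ n, q ⁻¹' (W n) := by
    ext u
    simp only [mem_preimage, mem_Ioi, mem_iUnion]
    constructor
    · intro h
      obtain ⟨n, hn⟩ := exists_nat_one_div_lt (sub_pos.2 h)
      refine ⟨n, hW1 n ?_⟩
      simp only [mem_ofPred_eq]; linarith
    · rintro ⟨n, hn⟩
      exact hW2 n hn
  rw [this]
  exact MeasurableSet.iUnion fun n => hW _ (hWm n)

theorem exists_open_of_rightCts {K : Type*} [LinearOrder K] [TopologicalSpace K] [OrderTopology K]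
    {G : K → ℝ} (hG : Monotone G) {t : K} (hr : ContinuousWithinAt G (Ici t) t) {c : ℝ}
    (hc : G t < c) : ∃ U, IsOpen U ∧ Iic t ⊆ U ∧ ∀ x ∈ U, G x < c := by
  have : {x | G x < c} ∈ 𝓝[Ici t] t := hr (Iio_mem_nhds hc)
  obtain ⟨V, hV, htV, hsub⟩ := mem_nhdsWithin.1 this
  refine ⟨Iio t ∪ V, isOpen_Iio.union hV, ?_, ?_⟩
  · intro x hx
    rcases lt_or_eq_of_le hx with h | rfl
    · exact Or.inl h
    · exact Or.inr htV
  · rintro x (hx | hx)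
    · exact (hG (le_of_lt hx)).trans_lt hc
    · rcases le_total t x with h | h
      · exact hsub ⟨hx, h⟩
      · exact (hG h).trans_lt hc

theorem exists_quantile {K : Type*} [LinearOrder K] [TopologicalSpace K] [OrderTopology K]
    [CompactSpace K] {G : K → ℝ} (hG : Monotone G)
    (hr : ∀ t, ContinuousWithinAt G (Ici t) t) (m : K) :
    ∃ q : ℝ → K, Monotone q ∧ ∀ u ≤ G m, ∀ t, q u ≤ t ↔ u ≤ G t := by
  have hcl : ∀ u, IsClosed {t | u ≤ G t} := fun u => by
    rw [← isOpen_compl_iff, isOpen_iff_mem_nhds]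
    intro t ht
    simp only [mem_compl_iff, mem_ofPred_eq, not_le] at ht
    obtain ⟨U, hU, h1, h2⟩ := exists_open_of_rightCts hG (hr t) ht
    filter_upwards [hU.mem_nhds (h1 self_mem_Iic)] with x hx
    simpa using h2 x hx
  have hex : ∀ u : ℝ, ∃ q, IsLeast {t | min u (G m) ≤ G t} q := fun u =>
    (hcl _).isCompact.exists_isLeast ⟨m, by simp⟩
  choose q hq using hex
  refine ⟨q, ?_, ?_⟩
  · intro u v huv
    exact (hq u).2 (le_trans (min_le_min_right _ huv) (hq v).1)
  · intro u hu t
    have h := hq u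
    rw [min_eq_left hu] at h
    exact ⟨fun h' => le_trans h.1 (hG h'), fun h' => h.2 h'⟩

end helpers

section helpers2
open Filter Topology CompactlySupported

theorem exists_regular_of_mono {K : Type*} [LinearOrder K] [TopologicalSpace K] [OrderTopology K]
    [CompactSpace K] [MeasurableSpace K] [BorelSpace K] {G : K → ℝ} (hG : Monotone G)
    (hr : ∀ t, ContinuousWithinAt G (Ici t) t) (h0 : ∀ t, 0 ≤ G t) (m : K) (hm : ∀ t, t ≤ m) :
    ∃ α : Measure K, IsFiniteMeasure α ∧ α.Regular ∧ ∀ t, α.real (Iic t) = G t := by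
  obtain ⟨q, hqm, hq⟩ := exists_quantile hG hr m
  have hint : ∀ f : K → ℝ, Continuous f →
      Integrable (fun u => f (q u)) (volume.restrict (Ioc 0 (G m))) := by
    intro f hf
    obtain ⟨c, hc⟩ := isCompact_univ.exists_bound_of_continuousOn hf.continuousOn
    exact Integrable.of_bound (measurable_comp_of_mono hqm hf).aestronglyMeasurable c
      (Eventually.of_forall fun u => hc _ trivial)
  let Λ : C_c(K, ℝ) →ₚ[ℝ] ℝ :=
  { toFun g := ∫ u in Ioc 0 (G m), g (q u)
    map_add' g g' := integral_add (hint g g.continuous) (hint g' g'.continuous)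
    map_smul' c g := integral_smul c (fun u => g (q u))
    monotone' g g' hgg' := integral_mono (hint g g.continuous) (hint g' g'.continuous)
      (fun u => hgg' (q u)) }
  have hΛ : ∀ f : K → ℝ, Continuous f →
      ∫ x, f x ∂(RealRMK.rieszMeasure Λ) = ∫ u in Ioc 0 (G m), f (q u) := by
    intro f hf
    let g : C_c(K, ℝ) :=
      { toFun := f
        hasCompactSupport' := HasCompactSupport.of_compactSpace _ }
    exact RealRMK.integral_rieszMeasure Λ g
  set α := RealRMK.rieszMeasure Λ with hα
  refine ⟨α, inferInstance, inferInstance, fun t => ?_⟩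
  have hfi : ∀ f : K → ℝ, Continuous f → Integrable f α := by
    intro f hf
    obtain ⟨c, hc⟩ := isCompact_univ.exists_bound_of_continuousOn hf.continuousOn
    exact Integrable.of_bound (hf.measurable).aestronglyMeasurable c
      (Eventually.of_forall fun u => hc _ trivial)
  have hind : ∀ (c : ℝ), 0 ≤ c →
      ∫ u in Ioc 0 (G m), (Iic c).indicator (fun _ => (1 : ℝ)) u = min c (G m) := by
    intro c hc
    rw [integral_indicator measurableSet_Iic, Measure.restrict_restrict measurableSet_Iic]
    have : Iic c ∩ Ioc 0 (G m) = Ioc 0 (min c (G m)) := by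
      ext x; simp only [mem_inter_iff, mem_Iic, mem_Ioc, le_min_iff]; tauto
    rw [this]
    simp [hc, h0]
  have hindi : ∀ c : ℝ, Integrable ((Iic c).indicator (fun _ => (1 : ℝ)))
      (volume.restrict (Ioc 0 (G m))) := fun c =>
    (integrable_const (1 : ℝ)).indicator measurableSet_Iic
  have ury : ∀ U, IsOpen U → Iic t ⊆ U → ∃ f : K → ℝ, Continuous f ∧ (∀ x, 0 ≤ f x) ∧
      (∀ x, f x ≤ 1) ∧ (∀ x ≤ t, f x = 1) ∧ ∀ x, x ∉ U → f x = 0 := by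
    intro U hU hsub
    obtain ⟨f, h1, h2, h3⟩ := exists_continuous_zero_one_of_isClosed (hU.isClosed_compl)
      (isClosed_Iic (a := t)) (by
        rw [Set.disjoint_left]; intro x hx hx'; exact hx (hsub hx'))
    exact ⟨f, f.continuous, fun x => (h3 x).1, fun x => (h3 x).2, fun x hx => h2 hx,
      fun x hx => h1 hx⟩
  apply le_antisymm
  · refine le_of_forall_gt_imp_ge_of_dense fun c hc => ?_
    obtain ⟨U, hU, h1, h2⟩ := exists_open_of_rightCts hG (hr t) hc
    obtain ⟨f, hf, f0, f1, ft, fU⟩ := ury U hU h1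
    calc α.real (Iic t) = ∫ x, (Iic t).indicator (fun _ => (1 : ℝ)) x ∂α := by
          rw [integral_indicator measurableSet_Iic]; simp
      _ ≤ ∫ x, f x ∂α := by
          refine integral_mono ((integrable_const _).indicator measurableSet_Iic) (hfi f hf) ?_
          intro x
          by_cases hx : x ≤ t
          · simp [hx, ft x hx]
          · simp [hx, f0 x]
      _ = ∫ u in Ioc 0 (G m), f (q u) := hΛ f hf
      _ ≤ ∫ u in Ioc 0 (G m), (Iic c).indicator (fun _ => (1 : ℝ)) u := by
          refine setIntegral_mono_on (hint f hf) (hindi c) measurableSet_Ioc ?_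
          intro u hu
          by_cases hx : q u ∈ U
          · have : u ≤ c := ((hq u hu.2 (q u)).1 le_rfl).trans (h2 _ hx).le
            simp [this, f1]
          · rw [fU _ hx]
            exact indicator_nonneg (fun _ _ => zero_le_one) _
      _ = min c (G m) := hind c ((h0 t).trans hc.le)
      _ ≤ c := min_le_left _ _
  · have : ENNReal.ofReal (G t) ≤ α (Iic t) := by
      rw [Set.measure_eq_iInf_isOpen]
      refine le_iInf₂ fun U hsub => le_iInf fun hU => ?_
      obtain ⟨f, hf, f0, f1, ft, fU⟩ := ury U hU hsub
      rw [← ENNReal.ofReal_toReal (measure_ne_top α U)]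
      apply ENNReal.ofReal_le_ofReal
      calc G t = min (G t) (G m) := (min_eq_left (hG (hm t))).symm
        _ = ∫ u in Ioc 0 (G m), (Iic (G t)).indicator (fun _ => (1 : ℝ)) u := (hind _ (h0 t)).symm
        _ ≤ ∫ u in Ioc 0 (G m), f (q u) := by
          refine setIntegral_mono_on (hindi _) (hint f hf) measurableSet_Ioc ?_
          intro u hu
          by_cases hx : u ≤ G t
          · have := ft _ ((hq u hu.2 t).2 hx)
            simp [this, indicator, hx]
          · simp [hx, f0]
        _ = ∫ x, f x ∂α := (hΛ f hf).symm
        _ ≤ ∫ x, U.indicator (fun _ => (1 : ℝ)) x ∂α := by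
          refine integral_mono (hfi f hf) ((integrable_const _).indicator hU.measurableSet) ?_
          intro x
          by_cases hx : x ∈ U
          · simp [hx, f1 x]
          · simp [hx, fU x hx]
        _ = (α U).toReal := by
          rw [integral_indicator hU.measurableSet]; simp [Measure.real]
    exact (ENNReal.ofReal_le_iff_le_toReal (measure_ne_top _ _)).1 this

theorem totalVariation_sub_le {K : Type*} [MeasurableSpace K] (α β : Measure K)
    [IsFiniteMeasure α] [IsFiniteMeasure β] :
    (α.toSignedMeasure - β.toSignedMeasure).totalVariation ≤ α + β := by
  set μ := α.toSignedMeasure - β.toSignedMeasure with hμ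
  obtain ⟨i, h1, h2, h3, hp, hn⟩ := μ.toJordanDecomposition_spec
  rw [SignedMeasure.totalVariation]
  refine add_le_add ?_ ?_
  · refine Measure.le_iff.2 fun s hs => ?_
    rw [hp, SignedMeasure.toMeasureOfZeroLE_apply _ _ _ hs,
      ← ENNReal.ofReal_toReal (measure_ne_top α s), ← ENNReal.ofReal_coe_nnreal]
    apply ENNReal.ofReal_le_ofReal
    show μ (i ∩ s) ≤ _
    rw [hμ, Measure.toSignedMeasure_sub_apply (h1.inter hs)]
    have : α.real (i ∩ s) ≤ α.real s := measureReal_mono inter_subset_right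
    have h' : 0 ≤ β.real (i ∩ s) := measureReal_nonneg
    change _ ≤ α.real s
    linarith
  · refine Measure.le_iff.2 fun s hs => ?_
    rw [hn, SignedMeasure.toMeasureOfLEZero_apply _ _ _ hs,
      ← ENNReal.ofReal_toReal (measure_ne_top β s), ← ENNReal.ofReal_coe_nnreal]
    apply ENNReal.ofReal_le_ofReal
    show -μ (iᶜ ∩ s) ≤ _
    rw [hμ, Measure.toSignedMeasure_sub_apply (h1.compl.inter hs)]
    have : β.real (iᶜ ∩ s) ≤ β.real s := measureReal_mono inter_subset_right
    have h' : 0 ≤ α.real (iᶜ ∩ s) := measureReal_nonneg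
    change _ ≤ β.real s
    linarith

theorem sum_telescope (n : ℕ) (H : Fin (n + 1) → ℝ) :
    ∑ i : Fin n, (H i.succ - H i.castSucc) = H (Fin.last n) - H 0 := by
  induction n with
  | zero => simp
  | succ n ih =>
    rw [Fin.sum_univ_castSucc]
    have := ih (fun i => H i.castSucc)
    simp only [Fin.castSucc_zero] at this
    simp only [Fin.succ_castSucc, Fin.succ_last] at this ⊢
    rw [this]; ring

end helpers2
section helpers3
open Filter Topology

theorem sum_le_eVariationOn {K : Type*} [LinearOrder K] (F : K → ℝ) {n : ℕ} {t : Fin (n + 1) → K}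
    (ht : StrictMono t) :
    ENNReal.ofReal (∑ i : Fin n, |F (t i.succ) - F (t i.castSucc)|) ≤ eVariationOn F univ := by
  let u : ℕ → K := fun i => t ⟨min i n, by omega⟩
  have hu : Monotone u := fun i j hij => ht.monotone (by
    simp only [Fin.mk_le_mk]; omega)
  refine le_trans (le_of_eq ?_)
    (eVariationOn.sum_le (f := F) (s := univ) (n := n) hu (fun _ => trivial))
  rw [ENNReal.ofReal_sum_of_nonneg (fun _ _ => abs_nonneg _), ← Fin.sum_univ_eq_sum_range
    (fun i => edist (F (u (i + 1))) (F (u i))) n]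
  refine Finset.sum_congr rfl fun i _ => ?_
  rw [edist_dist, Real.dist_eq]
  have h1 : u (i + 1) = t i.succ := by
    simp only [u]; congr 1; ext; simp
  have h2 : u i = t i.castSucc := by
    simp only [u]; congr 1; ext; simp
  rw [h1, h2]

theorem bv_facts {K : Type*} [LinearOrder K] [Nonempty K] {F : K → ℝ} (h : IsBV F) :
    BoundedVariationOn F univ ∧ variation F = (eVariationOn F univ).toReal := by
  have hle : eVariationOn F univ ≤ ENNReal.ofReal (variation F) := by
    rw [eVariationOn.eVariationOn_eq_strictMonoOn]
    refine iSup_le ?_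
    rintro ⟨n, u, hu, -⟩
    simp only
    have : ∑ i ∈ Finset.range n, edist (F (u (i + 1))) (F (u i)) =
        ENNReal.ofReal (∑ i : Fin n, |F (u (i.succ : Fin (n+1))) -
          F (u (i.castSucc : Fin (n + 1)))|) := by
      rw [ENNReal.ofReal_sum_of_nonneg (fun _ _ => abs_nonneg _), ← Fin.sum_univ_eq_sum_range
        (fun i => edist (F (u (i + 1))) (F (u i))) n]
      refine Finset.sum_congr rfl fun i _ => ?_
      rw [edist_dist, Real.dist_eq]
      simp
    rw [this]
    apply ENNReal.ofReal_le_ofReal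
    refine le_csSup h ⟨n, fun i => u i, ?_, rfl⟩
    intro i j hij
    exact hu (by simp only [mem_Iic]; omega) (by simp only [mem_Iic]; omega) hij
  have hb : BoundedVariationOn F univ := ne_top_of_le_ne_top ENNReal.ofReal_ne_top hle
  have hne : {v | ∃ (n : ℕ) (t : Fin (n + 1) → K), StrictMono t ∧
      v = ∑ i : Fin n, |F (t i.succ) - F (t i.castSucc)|}.Nonempty := by
    refine ⟨0, 0, fun _ => Classical.arbitrary K, ?_, by simp⟩
    intro i j hij
    exact absurd hij (by omega)
  have hge : variation F ≤ (eVariationOn F univ).toReal := by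
    refine csSup_le hne ?_
    rintro v ⟨n, t, ht, rfl⟩
    exact (ENNReal.ofReal_le_iff_le_toReal hb).1 (sum_le_eVariationOn F ht)
  refine ⟨hb, le_antisymm hge ?_⟩
  refine ENNReal.toReal_le_of_le_ofReal ?_ hle
  obtain ⟨v, hv⟩ := hne
  have h0 : 0 ≤ v := by
    obtain ⟨n, t, ht, rfl⟩ := hv
    exact Finset.sum_nonneg fun _ _ => abs_nonneg _
  exact h0.trans (le_csSup h hv)

theorem exists_pair {K : Type*} [LinearOrder K] [TopologicalSpace K] [OrderTopology K]
    [CompactSpace K] [Nonempty K] [MeasurableSpace K] [BorelSpace K]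
    (z : K) (hz : ∀ t, z ≤ t) {F : K → ℝ} (hF : IsBV F) (hr : RightCts F) :
    ∃ α β : Measure K, IsFiniteMeasure α ∧ IsFiniteMeasure β ∧ α.Regular ∧ β.Regular ∧
      (∀ t, α.real (Iic t) - β.real (Iic t) = F t) ∧
      α.real univ + β.real univ = |F z| + variation F := by
  obtain ⟨m, hm⟩ : ∃ m : K, ∀ t, t ≤ m := by
    obtain ⟨m, hm⟩ := isCompact_univ.exists_isGreatest (univ_nonempty (α := K))
    exact ⟨m, fun t => hm.2 trivial⟩
  obtain ⟨hb, hv⟩ := bv_facts hF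
  have hl := hb.locallyBoundedVariationOn
  set V := variationOnFromTo F univ z with hV
  have hVz : V z = 0 := variationOnFromTo.self _ _ _
  have hVm : V m = variation F := by
    rw [hv, hV, variationOnFromTo.eq_of_le _ _ (hz m)]
    congr 2
    ext x; simp [hz, hm]
  have hVr : ∀ t, ContinuousWithinAt V (Ici t) t := fun t =>
    hb.continuousWithinAt_variationOnFromTo_Ici (hr t)
  have key : ∀ s t, s ≤ t → |F t - F s| ≤ V t - V s := fun s t hst =>
    variationOnFromTo.abs_sub_le_sub_of_le hl trivial trivial trivial hst
  have m1 : Monotone fun t => (|F z| + V t + F t) / 2 := fun s t hst => by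
    have := abs_le.1 (key s t hst)
    simp only; linarith
  have m2 : Monotone fun t => (|F z| + V t - F t) / 2 := fun s t hst => by
    have := abs_le.1 (key s t hst)
    simp only; linarith
  have p1 : ∀ t, 0 ≤ (|F z| + V t + F t) / 2 := fun t => by
    refine le_trans ?_ (m1 (hz t))
    have := neg_abs_le (F z)
    simp only [hVz]; linarith
  have p2 : ∀ t, 0 ≤ (|F z| + V t - F t) / 2 := fun t => by
    refine le_trans ?_ (m2 (hz t))
    have := le_abs_self (F z)
    simp only [hVz]; linarith
  obtain ⟨α, a1, a2, a3⟩ := exists_regular_of_mono m1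
    (fun t => ((continuousWithinAt_const.add (hVr t)).add (hr t)).div_const 2) p1 m hm
  obtain ⟨β, b1, b2, b3⟩ := exists_regular_of_mono m2
    (fun t => ((continuousWithinAt_const.add (hVr t)).sub (hr t)).div_const 2) p2 m hm
  refine ⟨α, β, a1, b1, a2, b2, fun t => ?_, ?_⟩
  · rw [a3, b3]; ring
  · have : (univ : Set K) = Iic m := by ext x; simp [hm]
    rw [this, a3, b3, ← hVm]; ring

theorem tv_facts {K : Type*} [MeasurableSpace K] (μ : SignedMeasure K) :
    IsFiniteMeasure μ.totalVariation ∧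
    ∀ s, MeasurableSet s → |μ s| ≤ μ.totalVariation.real s := by
  have hfin : IsFiniteMeasure μ.totalVariation := by
    unfold SignedMeasure.totalVariation; infer_instance
  refine ⟨hfin, fun s hs => ?_⟩
  rw [SignedMeasure.apply_eq_posPart_real_sub_negPart_real μ hs, SignedMeasure.totalVariation,
    measureReal_add_apply]
  have h1 : 0 ≤ μ.toJordanDecomposition.posPart.real s := measureReal_nonneg
  have h2 : 0 ≤ μ.toJordanDecomposition.negPart.real s := measureReal_nonneg
  rw [abs_le]; constructor <;> linarith

theorem cdf_le {K : Type*} [LinearOrder K] [TopologicalSpace K] [OrderTopology K]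
    [MeasurableSpace K] [BorelSpace K] (μ : SignedMeasure K) {s t : K} (h : s ≤ t) :
    |μ (Iic t) - μ (Iic s)| ≤ μ.totalVariation.real (Iic t) - μ.totalVariation.real (Iic s) := by
  obtain ⟨hfin, hle⟩ := tv_facts μ
  have h1 : μ (Iic s) + μ (Iic t \ Iic s) = μ (Iic t) :=
    VectorMeasure.of_add_of_sdiff measurableSet_Iic measurableSet_Iic (Iic_subset_Iic.2 h)
  have h2 : μ.totalVariation.real (Iic t \ Iic s) = _ :=
    measureReal_sdiff (Iic_subset_Iic.2 h) measurableSet_Iic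
  rw [← h2, ← h1, add_sub_cancel_left]
  exact hle _ (measurableSet_Iic.diff measurableSet_Iic)

theorem cdf_sum_le {K : Type*} [LinearOrder K] [TopologicalSpace K] [OrderTopology K]
    [MeasurableSpace K] [BorelSpace K] (z : K) (hz : ∀ t, z ≤ t) (μ : SignedMeasure K)
    {v : ℝ} (hv : ∃ (n : ℕ) (t : Fin (n + 1) → K), StrictMono t ∧
      v = ∑ i : Fin n, |μ (Iic (t i.succ)) - μ (Iic (t i.castSucc))|) :
    v ≤ μ.totalVariation.real univ - |μ (Iic z)| := by
  obtain ⟨hfin, hle⟩ := tv_facts μ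
  obtain ⟨n, t, ht, rfl⟩ := hv
  have h1 := Finset.sum_le_sum fun (i : Fin n) (_ : i ∈ Finset.univ) =>
    cdf_le μ (ht.monotone (Fin.castSucc_lt_succ (i := i)).le)
  rw [sum_telescope n (fun i => μ.totalVariation.real (Iic (t i)))] at h1
  have h2 : μ.totalVariation.real (Iic (t (Fin.last n))) ≤ μ.totalVariation.real univ :=
    measureReal_mono (subset_univ _)
  have h3 : μ.totalVariation.real (Iic z) ≤ μ.totalVariation.real (Iic (t 0)) :=
    measureReal_mono (Iic_subset_Iic.2 (hz _))
  have h4 := hle (Iic z) measurableSet_Iic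
  linarith

theorem cdf_nbv {K : Type*} [LinearOrder K] [TopologicalSpace K] [OrderTopology K]
    [MeasurableSpace K] [BorelSpace K] (z : K) (hz : ∀ t, z ≤ t) (μ : SignedMeasure K)
    (hμ : μ.totalVariation.Regular) :
    IsBV (fun t => μ (Iic t)) ∧ RightCts (fun t => μ (Iic t)) := by
  obtain ⟨hfin, hle⟩ := tv_facts μ
  refine ⟨⟨_, fun v hv => cdf_sum_le z hz μ hv⟩, fun t => ?_⟩
  rw [Metric.continuousWithinAt_iff']
  intro ε hε
  obtain ⟨U, hsub, hU, hlt⟩ := (Iic t).exists_isOpen_lt_add (μ := μ.totalVariation)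
    (measure_ne_top _ _) (ENNReal.ofReal_pos.2 hε).ne'
  have hlt' : μ.totalVariation.real U < μ.totalVariation.real (Iic t) + ε := by
    have := (ENNReal.toReal_lt_toReal (measure_ne_top _ _) (by finiteness)).2 hlt
    rwa [ENNReal.toReal_add (measure_ne_top _ _) ENNReal.ofReal_ne_top,
      ENNReal.toReal_ofReal hε.le] at this
  have hnear : ∀ᶠ x in 𝓝[Ici t] t, Iic x ⊆ U := by
    have hUn : U ∈ 𝓝[≥] t := mem_nhdsWithin_of_mem_nhds (hU.mem_nhds (hsub self_mem_Iic))
    by_cases hmax : ∃ s, t < s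
    · obtain ⟨s, hs⟩ := hmax
      obtain ⟨b, hb, hb2⟩ := (mem_nhdsGE_iff_exists_Ico_subset' hs).1 hUn
      filter_upwards [Ico_mem_nhdsGE hb] with x hx y hy
      rcases le_total y t with h | h
      · exact hsub h
      · exact hb2 ⟨h, lt_of_le_of_lt hy hx.2⟩
    · push Not at hmax
      filter_upwards with x y hy
      exact hsub (le_trans hy (hmax x))
  filter_upwards [hnear, self_mem_nhdsWithin] with x hx htx
  rw [Real.dist_eq]
  have h1 := cdf_le μ htx
  have h2 : μ.totalVariation.real (Iic x) ≤ μ.totalVariation.real U := measureReal_mono hx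
  linarith

end helpers3

theorem stmt6 {K : Type*} [LinearOrder K] [TopologicalSpace K] [OrderTopology K]
    [CompactSpace K] [Nonempty K] [MeasurableSpace K] [BorelSpace K]
    (z : K) (hz : ∀ t, z ≤ t) :
    -- the map `μ ↦ F_μ` takes values in `NBV(K)`
    (∀ μ : SignedMeasure K, μ.totalVariation.Regular →
      IsBV (fun t => μ (Set.Iic t)) ∧ RightCts (fun t => μ (Set.Iic t))) ∧
    -- it is linear
    (∀ μ ν : SignedMeasure K, ∀ a : ℝ, ∀ t : K,
      (a • μ + ν) (Set.Iic t) = a * μ (Set.Iic t) + ν (Set.Iic t)) ∧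
    -- it is an isometry
    (∀ μ : SignedMeasure K, μ.totalVariation.Regular →
      |μ (Set.Iic z)| + variation (fun t => μ (Set.Iic t))
        = (μ.totalVariation Set.univ).toReal) ∧
    -- it is onto `NBV(K)`
    (∀ F : K → ℝ, IsBV F → RightCts F →
      ∃ μ : SignedMeasure K, μ.totalVariation.Regular ∧
        ∀ t : K, μ (Set.Iic t) = F t) := by
  have hregadd : ∀ α β : Measure K, IsFiniteMeasure α → IsFiniteMeasure β → α.Regular → β.Regular →
      (α + β).Regular := by
    intro α β _ _ _ _
    infer_instance
  refine ⟨fun μ hμ => cdf_nbv z hz μ hμ, fun μ ν a t => by simp, fun μ hμ => ?_, fun F hF hr => ?_⟩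
  · obtain ⟨hfin, hle⟩ := tv_facts μ
    obtain ⟨hbv, hr⟩ := cdf_nbv z hz μ hμ
    apply le_antisymm
    · have : variation (fun t => μ (Iic t)) ≤ μ.totalVariation.real univ - |μ (Iic z)| := by
        refine csSup_le ?_ fun v hv => cdf_sum_le z hz μ hv
        refine ⟨0, 0, fun _ => z, ?_, by simp⟩
        intro i j hij
        exact absurd hij (by omega)
      change _ ≤ μ.totalVariation.real univ
      linarith
    · obtain ⟨α, β, a1, b1, a2, b2, hF, hsum⟩ := exists_pair z hz hbv hr
      set P := μ.toJordanDecomposition.posPart with hP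
      set N := μ.toJordanDecomposition.negPart with hN
      have htv : μ.totalVariation = P + N := rfl
      have hPr : P.Regular := regular_of_le hμ (by rw [htv]; exact Measure.le_add_right le_rfl)
      have hNr : N.Regular := regular_of_le hμ (by rw [htv]; exact Measure.le_add_left le_rfl)
      have r1 := hregadd P β inferInstance b1 hPr b2
      have r2 := hregadd α N a1 inferInstance a2 hNr
      have heq : P + β = α + N := by
        apply regular_unique
        intro t
        have h1 := SignedMeasure.apply_eq_posPart_real_sub_negPart_real μ
          (measurableSet_Iic (a := t))
        rw [← measureReal_eq_measureReal_iff, measureReal_add_apply, measureReal_add_apply]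
        have h2 := hF t
        linarith
      have hμeq : μ = α.toSignedMeasure - β.toSignedMeasure := by
        ext s hs
        rw [SignedMeasure.apply_eq_posPart_real_sub_negPart_real μ hs,
          Measure.toSignedMeasure_sub_apply hs]
        have h3 : (P + β).real s = (α + N).real s := by rw [heq]
        rw [measureReal_add_apply, measureReal_add_apply] at h3
        linarith
      have h4 : μ.totalVariation ≤ α + β := by
        rw [hμeq]; exact totalVariation_sub_le α β
      rw [← hsum, ← measureReal_add_apply]
      exact ENNReal.toReal_mono (measure_ne_top _ _) (h4 univ)
  · obtain ⟨α, β, a1, b1, a2, b2, hF', -⟩ := exists_pair z hz hF hr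
    refine ⟨α.toSignedMeasure - β.toSignedMeasure,
      regular_of_le (hregadd α β a1 b1 a2 b2) (totalVariation_sub_le α β), fun t => ?_⟩
    rw [Measure.toSignedMeasure_sub_apply measurableSet_Iic]
    exact hF' t
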